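/- arXiv:2510.02039 — 4 statements merged into one kernel-verified Lean document; each statement's English description precedes it below -/
import Mathlib

section
/- Let u : ℝ × ℝⁿ → ℝⁿ be C¹, let v : ℝ × ℝⁿ → ℝᵏ be C¹, and let a : ℝ × ℝⁿ → Matrix k k ℝ be continuous with a(t,x) skew-symmetric (a(t,x)ᵀ = -a(t,x)) for all (t,x). Assume v satisfies the vector half-density transport equation ∂_t v = -(D_x v) u - (1/2)(div_x u) v + a v pointwise. Then the scalar density ρ(t,x) := ‖v(t,x)‖² satisfies the continuity equation ∂_t ρ + div_x(ρ u) = 0, i.e., ∂_t ρ(t,x) + ⟨∇_x ρ(t,x), u(t,x)⟩ + ρ(t,x) · div_x u(t,x) = 0 for all (t,x). -/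
open Matrix

noncomputable section

attribute [local instance] Matrix.normedAddCommGroup Matrix.normedSpace

/-- The divergence of a vector field on `ℝⁿ`: the trace of its Fréchet derivative. -/
def sdiv {n : ℕ} (w : EuclideanSpace ℝ (Fin n) → EuclideanSpace ℝ (Fin n))
    (x : EuclideanSpace ℝ (Fin n)) : ℝ :=
  LinearMap.trace ℝ (EuclideanSpace ℝ (Fin n)) (fderiv ℝ w x).toLinearMap

/-- A skew-symmetric matrix sends every vector to an orthogonal vector. -/
theorem inner_toEuclideanLin_self_eq_zero {k : ℕ} {A : Matrix (Fin k) (Fin k) ℝ}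
    (hA : Aᵀ = -A) (w : EuclideanSpace ℝ (Fin k)) :
    inner ℝ w (Matrix.toEuclideanLin A w) = 0 := by
  have hadj : inner ℝ w (Matrix.toEuclideanLin A w) =
      inner ℝ (Matrix.toEuclideanLin Aᴴ w) w := by
    rw [Matrix.toEuclideanLin_conjTranspose_eq_adjoint, LinearMap.adjoint_inner_left]
  rw [Matrix.conjTranspose_eq_transpose_of_trivial, hA, map_neg, LinearMap.neg_apply,
    inner_neg_left, real_inner_comm w] at hadj
  linarith

/-- If a vector half-density `v` is transported by
`∂ₜ v = -(Dₓ v) u - (1/2)(div u) v + a v` with `a` skew-symmetric, then the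
scalar density `ρ = ‖v‖²` satisfies the continuity equation
`∂ₜ ρ + ⟨∇ₓ ρ, u⟩ + ρ · div u = 0`. -/
theorem halfDensity_transport_continuity {n k : ℕ}
    (u : ℝ × EuclideanSpace ℝ (Fin n) → EuclideanSpace ℝ (Fin n))
    (hu : ContDiff ℝ 1 u)
    (v : ℝ × EuclideanSpace ℝ (Fin n) → EuclideanSpace ℝ (Fin k))
    (hv : ContDiff ℝ 1 v)
    (a : ℝ × EuclideanSpace ℝ (Fin n) → Matrix (Fin k) (Fin k) ℝ)
    (ha : Continuous a)
    (haskew : ∀ (t : ℝ) (x : EuclideanSpace ℝ (Fin n)), (a (t, x))ᵀ = -a (t, x))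
    (htransport : ∀ (t : ℝ) (x : EuclideanSpace ℝ (Fin n)),
      deriv (fun s => v (s, x)) t =
        -(fderiv ℝ (fun y => v (t, y)) x (u (t, x)))
        - (((1 : ℝ) / 2) * sdiv (fun y => u (t, y)) x) • v (t, x)
        + Matrix.toEuclideanLin (a (t, x)) (v (t, x))) :
    ∀ (t : ℝ) (x : EuclideanSpace ℝ (Fin n)),
      deriv (fun s => ‖v (s, x)‖ ^ 2) t
      + @inner ℝ _ _ (gradient (fun y => ‖v (t, y)‖ ^ 2) x) (u (t, x))
      + ‖v (t, x)‖ ^ 2 * sdiv (fun y => u (t, y)) x = 0 := by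
  intro t x
  have hvd : Differentiable ℝ v := hv.differentiable one_ne_zero
  have htime : DifferentiableAt ℝ (fun s => v (s, x)) t := by fun_prop
  have hspace : DifferentiableAt ℝ (fun y => v (t, y)) x := by fun_prop
  have hskew := inner_toEuclideanLin_self_eq_zero (haskew t x) (v (t, x))
  rw [htime.hasDerivAt.norm_sq.deriv, gradient, InnerProductSpace.toDual_symm_apply,
    hspace.hasFDerivAt.norm_sq.fderiv, htransport t x]
  simp only [_root_.smul_apply, ContinuousLinearMap.comp_apply,
    innerSL_apply_apply, inner_add_right, inner_sub_right, inner_neg_right,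
    real_inner_smul_right, real_inner_self_eq_norm_sq, hskew, nsmul_eq_mul, Nat.cast_ofNat]
  ring

end
end

section
/- Let u : ℝⁿ → ℝⁿ be C¹ and compactly supported, and let v, θ : ℝⁿ → ℝᵏ and ρ : ℝⁿ → ℝ be C¹. Then the following integration-by-parts identity holds: ∫_{ℝⁿ} [ ⟨(Dv(x))(u(x)), θ(x)⟩ ρ(x) + (1/2)(⟨∇ρ(x), u(x)⟩ + ρ(x) div u(x)) ⟨v(x), θ(x)⟩ ] dx = (1/2) ∫_{ℝⁿ} [ ⟨(Dv(x))(u(x)), θ(x)⟩ - ⟨(Dθ(x))(u(x)), v(x)⟩ ] ρ(x) dx. -/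
open Matrix MeasureTheory

noncomputable section

section

variable {n : ℕ}

lemma sdiv_eq_sum
    {w : EuclideanSpace ℝ (Fin n) → EuclideanSpace ℝ (Fin n)}
    {x : EuclideanSpace ℝ (Fin n)} (hw : DifferentiableAt ℝ w x) :
    sdiv w x = ∑ i, fderiv ℝ (fun y => w y i) x (EuclideanSpace.single i 1) := by
  rw [sdiv, LinearMap.trace_eq_sum_inner _ (EuclideanSpace.basisFun (Fin n) ℝ)]
  refine Finset.sum_congr rfl fun i _ => ?_
  have h : HasFDerivAt (fun y => w y i)
      ((EuclideanSpace.proj i : EuclideanSpace ℝ (Fin n) →L[ℝ] ℝ).comp (fderiv ℝ w x)) x :=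
    (EuclideanSpace.proj i : EuclideanSpace ℝ (Fin n) →L[ℝ] ℝ).hasFDerivAt.comp x hw.hasFDerivAt
  simp [h.fderiv, EuclideanSpace.inner_single_left]

lemma fderiv_apply_eq_sum (f : EuclideanSpace ℝ (Fin n) → ℝ) (x y : EuclideanSpace ℝ (Fin n)) :
    fderiv ℝ f x y = ∑ i, y i * fderiv ℝ f x (EuclideanSpace.single i 1) := by
  conv_lhs => rw [← (EuclideanSpace.basisFun (Fin n) ℝ).sum_repr y]
  simp [map_sum]

lemma hasCompactSupport_euclideanSpace_apply
    {w : EuclideanSpace ℝ (Fin n) → EuclideanSpace ℝ (Fin n)}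
    (h : HasCompactSupport w) (i : Fin n) :
    HasCompactSupport fun x => w x i :=
  h.comp_left (g := fun y : EuclideanSpace ℝ (Fin n) => y i) rfl

/-- The divergence `div (f u) = Df(u) + f div u` of a compactly supported `C¹` vector field
is integrable and has integral zero. -/
lemma integrable_and_integral_fderiv_add_mul_sdiv_eq_zero
    {u : EuclideanSpace ℝ (Fin n) → EuclideanSpace ℝ (Fin n)}
    (hu : ContDiff ℝ 1 u)
    (hsupp : HasCompactSupport u) {f : EuclideanSpace ℝ (Fin n) → ℝ} (hf : ContDiff ℝ 1 f) :
    Integrable (fun x => fderiv ℝ f x (u x) + f x * sdiv u x) ∧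
      ∫ x, (fderiv ℝ f x (u x) + f x * sdiv u x) = 0 := by
  have hui (i : Fin n) : ContDiff ℝ 1 fun x => u x i :=
    (EuclideanSpace.proj i : EuclideanSpace ℝ (Fin n) →L[ℝ] ℝ).contDiff.comp hu
  have hci := hasCompactSupport_euclideanSpace_apply hsupp
  have hderiv {g : EuclideanSpace ℝ (Fin n) → ℝ} (hg : ContDiff ℝ 1 g) (e : EuclideanSpace ℝ (Fin n)) :
      Continuous fun x => fderiv ℝ g x e :=
    (hg.continuous_fderiv one_ne_zero).clm_apply continuous_const
  have hI₁ (i : Fin n) :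
      Integrable fun x => u x i * fderiv ℝ f x (EuclideanSpace.single i 1) :=
    ((hui i).continuous.mul (hderiv hf _)).integrable_of_hasCompactSupport (hci i).mul_right
  have hI₂ (i : Fin n) :
      Integrable fun x => fderiv ℝ (fun y => u y i) x (EuclideanSpace.single i 1) * f x :=
    ((hderiv (hui i) _).mul hf.continuous).integrable_of_hasCompactSupport
      ((hci i).fderiv_apply ℝ _).mul_right
  have hparts (i : Fin n) := integral_mul_fderiv_eq_neg_fderiv_mul_of_integrable (hI₂ i) (hI₁ i)
    (((hui i).continuous.mul hf.continuous).integrable_of_hasCompactSupport (hci i).mul_right)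
    (fun x _ => (hui i).differentiable one_ne_zero x)
    (fun x _ => hf.differentiable one_ne_zero x)
  have hsum : (fun x => fderiv ℝ f x (u x) + f x * sdiv u x) =
      fun x => ∑ i, (u x i * fderiv ℝ f x (EuclideanSpace.single i 1) +
        fderiv ℝ (fun y => u y i) x (EuclideanSpace.single i 1) * f x) := by
    funext x
    rw [fderiv_apply_eq_sum, sdiv_eq_sum (hu.differentiable one_ne_zero x),
      Finset.sum_add_distrib, mul_comm (f x), Finset.sum_mul]
  have h_int (i : Fin n) : Integrable fun x =>
      u x i * fderiv ℝ f x (EuclideanSpace.single i 1) +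
        fderiv ℝ (fun y => u y i) x (EuclideanSpace.single i 1) * f x := (hI₁ i).add (hI₂ i)
  rw [hsum]
  refine ⟨integrable_finsetSum _ fun i _ => h_int i, ?_⟩
  rw [integral_finsetSum _ fun i _ => h_int i]
  refine Finset.sum_eq_zero fun i _ => ?_
  rw [integral_add (hI₁ i) (hI₂ i), hparts i, neg_add_cancel]

end

/-- Integration-by-parts identity: the `L²(ρ dx)`-pairing of the
half-density Lie derivative of `v ⊗ √ρ` against `θ ⊗ √ρ` equals the antisymmetrized
expression `(1/2) ∫ (⟨(Dv)u, θ⟩ - ⟨(Dθ)u, v⟩) ρ`. -/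
theorem halfDensity_integration_by_parts {n k : ℕ}
    (u : EuclideanSpace ℝ (Fin n) → EuclideanSpace ℝ (Fin n))
    (hu : ContDiff ℝ 1 u) (hsupp : HasCompactSupport u)
    (v θ : EuclideanSpace ℝ (Fin n) → EuclideanSpace ℝ (Fin k))
    (hv : ContDiff ℝ 1 v) (hθ : ContDiff ℝ 1 θ)
    (ρ : EuclideanSpace ℝ (Fin n) → ℝ) (hρ : ContDiff ℝ 1 ρ) :
    ∫ x, (@inner ℝ _ _ (fderiv ℝ v x (u x)) (θ x) * ρ x
        + (1 / 2 : ℝ) * (@inner ℝ _ _ (gradient ρ x) (u x) + ρ x * sdiv u x)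
          * @inner ℝ _ _ (v x) (θ x))
      = (1 / 2 : ℝ) * ∫ x, (@inner ℝ _ _ (fderiv ℝ v x (u x)) (θ x)
          - @inner ℝ _ _ (fderiv ℝ θ x (u x)) (v x)) * ρ x := by
  have hvθ : ContDiff ℝ 1 fun x => @inner ℝ _ _ (v x) (θ x) := hv.inner ℝ hθ
  obtain ⟨h_int, hzero⟩ :=
    integrable_and_integral_fderiv_add_mul_sdiv_eq_zero hu hsupp (hρ.mul hvθ)
  have hleib (x : EuclideanSpace ℝ (Fin n)) :
      fderiv ℝ (fun x => ρ x * @inner ℝ _ _ (v x) (θ x)) x (u x) =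
        ρ x * (@inner ℝ _ _ (fderiv ℝ v x (u x)) (θ x)
          + @inner ℝ _ _ (fderiv ℝ θ x (u x)) (v x))
          + @inner ℝ _ _ (v x) (θ x) * @inner ℝ _ _ (gradient ρ x) (u x) := by
    rw [fderiv_fun_mul (hρ.differentiable one_ne_zero x) (hvθ.differentiable one_ne_zero x),
      inner_gradient_left]
    simp only [_root_.add_apply, _root_.smul_apply, smul_eq_mul]
    rw [fderiv_inner_apply ℝ (hv.differentiable one_ne_zero x) (hθ.differentiable one_ne_zero x),
      real_inner_comm (fderiv ℝ θ x (u x)) (v x)]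
    ring
  have happly {w : EuclideanSpace ℝ (Fin n) → EuclideanSpace ℝ (Fin k)} (hw : ContDiff ℝ 1 w) :
      Continuous fun x => fderiv ℝ w x (u x) :=
    (hw.continuous_fderiv one_ne_zero).clm_apply hu.continuous
  have h_anti_int : Integrable fun x => (@inner ℝ _ _ (fderiv ℝ v x (u x)) (θ x)
      - @inner ℝ _ _ (fderiv ℝ θ x (u x)) (v x)) * ρ x := by
    refine Continuous.integrable_of_hasCompactSupport
      ((((happly hv).inner hθ.continuous).sub ((happly hθ).inner hv.continuous)).mul
        hρ.continuous) (hsupp.mono fun x hx hux => hx ?_)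
    simp [hux]
  calc
    _ = ∫ x, ((1 / 2 : ℝ) * ((@inner ℝ _ _ (fderiv ℝ v x (u x)) (θ x)
          - @inner ℝ _ _ (fderiv ℝ θ x (u x)) (v x)) * ρ x)
        + (1 / 2 : ℝ) * (fderiv ℝ (fun x => ρ x * @inner ℝ _ _ (v x) (θ x)) x (u x)
          + ρ x * @inner ℝ _ _ (v x) (θ x) * sdiv u x)) := by
      refine integral_congr_ae (.of_forall fun x => ?_)
      simp only [hleib]
      ring
    _ = _ := by
      rw [integral_add (h_anti_int.const_mul _) (h_int.const_mul _), integral_const_mul,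
        integral_const_mul, hzero, mul_zero, add_zero]

end
end

section
/- Let u : ℝ × ℝⁿ → ℝⁿ be C¹, let a : ℝ × ℝⁿ → Matrix k k ℝ be continuous, and let S : ℝ × ℝⁿ → Matrix k k ℝ be C¹ with S(t,x) symmetric for all (t,x). If S satisfies the matrix density transport equation ∂_t S = -(D_x S) u - (div_x u) S + a S + S aᵀ pointwise, then the scalar density ρ(t,x) := tr(S(t,x)) satisfies ∂_t ρ + div_x(ρ u) = 2 tr(a S) pointwise. In particular, if the balancing constraint tr(a(t,x) S(t,x)) = 0 holds for all (t,x), then ρ satisfies the continuity equation ∂_t ρ + div_x(ρ u) = 0. -/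
open Matrix

noncomputable section

attribute [local instance] Matrix.normedAddCommGroup Matrix.normedSpace

/-- The trace of matrices as a continuous linear map. -/
def traceCLM (k : ℕ) : Matrix (Fin k) (Fin k) ℝ →L[ℝ] ℝ :=
  LinearMap.toContinuousLinearMap (Matrix.traceLinearMap (Fin k) ℝ ℝ)

theorem deriv_trace {k : ℕ} {A : ℝ → Matrix (Fin k) (Fin k) ℝ} {t : ℝ}
    (hA : DifferentiableAt ℝ A t) :
    deriv (fun τ => Matrix.trace (A τ)) t = Matrix.trace (deriv A t) :=
  ((traceCLM k).hasFDerivAt.comp_hasDerivAt t hA.hasDerivAt).deriv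

theorem inner_gradient_trace {E : Type*} [NormedAddCommGroup E] [InnerProductSpace ℝ E]
    [CompleteSpace E] {k : ℕ} {A : E → Matrix (Fin k) (Fin k) ℝ} {x : E}
    (hA : DifferentiableAt ℝ A x) (v : E) :
    inner ℝ (gradient (fun y => Matrix.trace (A y)) x) v = Matrix.trace (fderiv ℝ A x v) := by
  have h : fderiv ℝ (fun y => Matrix.trace (A y)) x = (traceCLM k).comp (fderiv ℝ A x) :=
    ((traceCLM k).hasFDerivAt.comp x hA.hasFDerivAt).fderiv
  rw [gradient, InnerProductSpace.toDual_symm_apply, h]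
  rfl

/-- If a matrix density `S` is transported by
`∂ₜ S = -(Dₓ S) u - (div u) S + a S + S aᵀ`, then the scalar density `ρ = tr S`
satisfies `∂ₜ ρ + div(ρ u) = 2 tr(a S)`; in particular, under the balancing
constraint `tr(a S) ≡ 0` it satisfies the continuity equation. -/
theorem matrix_density_transport_trace {n k : ℕ}
    (u : ℝ × EuclideanSpace ℝ (Fin n) → EuclideanSpace ℝ (Fin n))
    (hu : ContDiff ℝ 1 u)
    (a : ℝ × EuclideanSpace ℝ (Fin n) → Matrix (Fin k) (Fin k) ℝ)
    (ha : Continuous a)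
    (S : ℝ × EuclideanSpace ℝ (Fin n) → Matrix (Fin k) (Fin k) ℝ)
    (hS : ContDiff ℝ 1 S)
    (hSsymm : ∀ (t : ℝ) (x : EuclideanSpace ℝ (Fin n)), (S (t, x))ᵀ = S (t, x))
    (htransport : ∀ (t : ℝ) (x : EuclideanSpace ℝ (Fin n)),
      deriv (fun τ => S (τ, x)) t =
        -(fderiv ℝ (fun y => S (t, y)) x (u (t, x)))
        - sdiv (fun y => u (t, y)) x • S (t, x)
        + a (t, x) * S (t, x) + S (t, x) * (a (t, x))ᵀ) :
    (∀ (t : ℝ) (x : EuclideanSpace ℝ (Fin n)),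
      deriv (fun τ => Matrix.trace (S (τ, x))) t
        + @inner ℝ _ _ (gradient (fun y => Matrix.trace (S (t, y))) x) (u (t, x))
        + Matrix.trace (S (t, x)) * sdiv (fun y => u (t, y)) x
        = 2 * Matrix.trace (a (t, x) * S (t, x))) ∧
    ((∀ (t : ℝ) (x : EuclideanSpace ℝ (Fin n)),
        Matrix.trace (a (t, x) * S (t, x)) = 0) →
      ∀ (t : ℝ) (x : EuclideanSpace ℝ (Fin n)),
        deriv (fun τ => Matrix.trace (S (τ, x))) t
          + @inner ℝ _ _ (gradient (fun y => Matrix.trace (S (t, y))) x) (u (t, x))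
          + Matrix.trace (S (t, x)) * sdiv (fun y => u (t, y)) x = 0) := by
  have key : ∀ (t : ℝ) (x : EuclideanSpace ℝ (Fin n)),
      deriv (fun τ => Matrix.trace (S (τ, x))) t
        + @inner ℝ _ _ (gradient (fun y => Matrix.trace (S (t, y))) x) (u (t, x))
        + Matrix.trace (S (t, x)) * sdiv (fun y => u (t, y)) x
        = 2 * Matrix.trace (a (t, x) * S (t, x)) := by
    intro t x
    have hSd : Differentiable ℝ S := hS.differentiable one_ne_zero
    have hSt : DifferentiableAt ℝ (fun τ => S (τ, x)) t := by fun_prop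
    have hSx : DifferentiableAt ℝ (fun y => S (t, y)) x := by fun_prop
    have hsymm : Matrix.trace (S (t, x) * (a (t, x))ᵀ) = Matrix.trace (a (t, x) * S (t, x)) := by
      rw [← Matrix.trace_transpose, Matrix.transpose_mul, Matrix.transpose_transpose, hSsymm]
    rw [deriv_trace hSt, inner_gradient_trace hSx, htransport t x, Matrix.trace_add,
      Matrix.trace_add, Matrix.trace_sub, Matrix.trace_neg, Matrix.trace_smul, hsymm, smul_eq_mul]
    ring
  exact ⟨key, fun hbal t x => by rw [key, hbal, mul_zero]⟩

end
end

section
/- Let u : ℝ × ℝⁿ → ℝⁿ be continuous, let a : ℝ × ℝⁿ → Matrix k k ℝ be continuous, and let S : ℝ × ℝⁿ → Matrix k k ℝ be C¹ with S(t,x) symmetric for all (t,x). If S satisfies the normalized matrix transport equation ∂_t S = -(D_x S) u + a S + S aᵀ - 2 tr(a S) S pointwise, then the function g(t,x) := tr(S(t,x)) satisfies ∂_t g + ⟨∇_x g, u⟩ = 2 tr(a S) (1 - g) pointwise. In particular, the hypersurface {tr S = 1} is invariant: wherever tr S = 1 the material derivative of tr S vanishes, consistent with the normalization tr S ≡ 1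 of matrix probability densities. -/
open Matrix

noncomputable section

attribute [local instance] Matrix.normedAddCommGroup Matrix.normedSpace

theorem hasFDerivAt_trace_comp {E : Type*} [NormedAddCommGroup E] [NormedSpace ℝ E] {k : ℕ}
    {f : E → Matrix (Fin k) (Fin k) ℝ} {x : E} (hf : DifferentiableAt ℝ f x) :
    HasFDerivAt (fun y => Matrix.trace (f y))
      ((Matrix.traceLinearMap (Fin k) ℝ ℝ).toContinuousLinearMap.comp (fderiv ℝ f x)) x :=
  (Matrix.traceLinearMap (Fin k) ℝ ℝ).toContinuousLinearMap.hasFDerivAt.comp x hf.hasFDerivAt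

theorem deriv_trace_comp {k : ℕ} {f : ℝ → Matrix (Fin k) (Fin k) ℝ} {t : ℝ}
    (hf : DifferentiableAt ℝ f t) :
    deriv (fun τ => Matrix.trace (f τ)) t = Matrix.trace (deriv f t) :=
  (hasFDerivAt_trace_comp hf).hasDerivAt.deriv

theorem inner_gradient_trace_comp {E : Type*} [NormedAddCommGroup E] [InnerProductSpace ℝ E]
    [CompleteSpace E] {k : ℕ} {f : E → Matrix (Fin k) (Fin k) ℝ} {x : E}
    (hf : DifferentiableAt ℝ f x) (v : E) :
    inner ℝ (gradient (fun y => Matrix.trace (f y)) x) v = Matrix.trace (fderiv ℝ f x v) := by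
  rw [gradient, InnerProductSpace.toDual_symm_apply, (hasFDerivAt_trace_comp hf).fderiv]
  rfl

theorem trace_mul_transpose_of_isSymm {k : ℕ} (A : Matrix (Fin k) (Fin k) ℝ)
    {B : Matrix (Fin k) (Fin k) ℝ} (hB : Bᵀ = B) :
    Matrix.trace (B * Aᵀ) = Matrix.trace (A * B) := by
  rw [← Matrix.trace_transpose, Matrix.transpose_mul, Matrix.transpose_transpose, hB]

/-- If the trace-normalized part `S` of a matrix density evolves by
`∂ₜ S = -(Dₓ S) u + a S + S aᵀ - 2 tr(a S) S`, then `g = tr S` satisfies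
`∂ₜ g + ⟨∇ₓ g, u⟩ = 2 tr(a S)(1 - g)`; in particular the hypersurface `{tr S = 1}`
is invariant: wherever `tr S = 1` the material derivative of `tr S` vanishes. -/
theorem normalized_matrix_transport_trace {n k : ℕ}
    (u : ℝ × EuclideanSpace ℝ (Fin n) → EuclideanSpace ℝ (Fin n))
    (hu : Continuous u)
    (a : ℝ × EuclideanSpace ℝ (Fin n) → Matrix (Fin k) (Fin k) ℝ)
    (ha : Continuous a)
    (S : ℝ × EuclideanSpace ℝ (Fin n) → Matrix (Fin k) (Fin k) ℝ)
    (hS : ContDiff ℝ 1 S)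
    (hSsymm : ∀ (t : ℝ) (x : EuclideanSpace ℝ (Fin n)), (S (t, x))ᵀ = S (t, x))
    (htransport : ∀ (t : ℝ) (x : EuclideanSpace ℝ (Fin n)),
      deriv (fun τ => S (τ, x)) t =
        -(fderiv ℝ (fun y => S (t, y)) x (u (t, x)))
        + a (t, x) * S (t, x) + S (t, x) * (a (t, x))ᵀ
        - (2 * Matrix.trace (a (t, x) * S (t, x))) • S (t, x)) :
    ∀ (t : ℝ) (x : EuclideanSpace ℝ (Fin n)),
      (deriv (fun τ => Matrix.trace (S (τ, x))) t
        + @inner ℝ _ _ (gradient (fun y => Matrix.trace (S (t, y))) x) (u (t, x))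
        = 2 * Matrix.trace (a (t, x) * S (t, x)) * (1 - Matrix.trace (S (t, x)))) ∧
      (Matrix.trace (S (t, x)) = 1 →
        deriv (fun τ => Matrix.trace (S (τ, x))) t
          + @inner ℝ _ _ (gradient (fun y => Matrix.trace (S (t, y))) x) (u (t, x))
          = 0) := by
  intro t x
  have hd : Differentiable ℝ S := hS.differentiable one_ne_zero
  have ht : DifferentiableAt ℝ (fun τ => S (τ, x)) t := by fun_prop
  have hx : DifferentiableAt ℝ (fun y => S (t, y)) x := by fun_prop
  have key : deriv (fun τ => Matrix.trace (S (τ, x))) t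
        + @inner ℝ _ _ (gradient (fun y => Matrix.trace (S (t, y))) x) (u (t, x))
        = 2 * Matrix.trace (a (t, x) * S (t, x)) * (1 - Matrix.trace (S (t, x))) := by
    rw [deriv_trace_comp ht, inner_gradient_trace_comp hx, htransport, Matrix.trace_sub,
      Matrix.trace_add, Matrix.trace_add, Matrix.trace_neg, Matrix.trace_smul,
      trace_mul_transpose_of_isSymm _ (hSsymm t x), smul_eq_mul]
    ring
  refine ⟨key, fun h => ?_⟩
  rw [key, h, sub_self, mul_zero]

end
end
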